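/- Let v = 1100 and w = 1010. Then for every p ∈ (0,1), Win(v,w;p) = (1 + p(1−p))/(2 + p(1−p)). -/

import Mathlib

open scoped BigOperators

/-- Bernoulli(p) weight of a binary word `u`: `ℙ_p(u) = p^{‖u‖₁} (1-p)^{‖u‖₀}`. -/
noncomputable def wProb (p : ℝ) (u : List Bool) : ℝ :=
  p ^ (u.count true) * (1 - p) ^ (u.count false)

/-- Number of occurrences of `v` as a contiguous subword of `u`. -/
def occCount (v u : List Bool) : ℕ :=
  (List.range (u.length + 1)).countP (fun i => decide (v <+: u.drop i))

/-- `Ω_{v,w}(v)`: binary words having `v` as a suffix, containing `v` exactly once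
as a subword, and not containing `w` as a subword.  (`Ω_{v,w}(w) = OmegaWin w v`.) -/
def OmegaWin (v w : List Bool) : Set (List Bool) :=
  {u | v <:+ u ∧ occCount v u = 1 ∧ ¬ (w <:+: u)}

/-- The win probability `Win(v,w;p) = ∑_{u ∈ Ω_{v,w}(v)} ℙ_p(u)`. -/
noncomputable def Win (v w : List Bool) (p : ℝ) : ℝ :=
  ∑' u : OmegaWin v w, wProb p u

/-- The correlation polynomial `vw_p = ∑_{u ∈ O(v,w)} ℙ_p(u)⁻¹`, where `O(v,w)` is
the set of nonempty words that are simultaneously a suffix of `v` and a prefix of `w`. -/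
noncomputable def corr (v w : List Bool) (p : ℝ) : ℝ :=
  ∑ i ∈ Finset.Icc 1 w.length,
    if w.take i <:+ v then (wProb p (w.take i))⁻¹ else 0

/-- `Ω*_{v,w}(v) = {x : x ++ v ∈ Ω_{v,w}(v)}` (with `x` possibly empty). -/
def OmegaStarV (v w : List Bool) : Set (List Bool) :=
  {x | x ++ v ∈ OmegaWin v w}

/-- Property `R`: `Ω*_{v,w}(v) = Ω*_{v,w}(w)`. -/
def PropR (v w : List Bool) : Prop :=
  OmegaStarV v w = {x | x ++ w ∈ OmegaWin w v}

/-- `D(v,w)`: nonempty proper prefixes `v₁⋯v_{n-k}` of `v` (`1 ≤ k ≤ n-1`) such that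
`w₁⋯w_k = v_{n-k+1}⋯v_n`. -/
def Dset (v w : List Bool) : Set (List Bool) :=
  {x | ∃ k, 1 ≤ k ∧ k ≤ v.length - 1 ∧ k ≤ w.length ∧
    x = v.take (v.length - k) ∧ w.take k = v.drop (v.length - k)}

/-- `F(v,w) = D(v,v) ∪ D(w,w) ∪ D(w,v) ∪ D(v,w)`. -/
def Fset (v w : List Bool) : Set (List Bool) :=
  Dset v v ∪ Dset w w ∪ Dset w v ∪ Dset v w

/-- `a^m`: concatenation of `m` copies of the word `a`. -/
def wpow (a : List Bool) (m : ℕ) : List Bool :=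
  (List.replicate m a).flatten

/-- The finset of binary words of length `n`. -/
def binaryWords : ℕ → Finset (List Bool)
  | 0 => {[]}
  | n + 1 => (binaryWords n).map ⟨List.cons true, List.cons_injective⟩ ∪
      (binaryWords n).map ⟨List.cons false, List.cons_injective⟩

theorem mem_binaryWords {n : ℕ} {u : List Bool} : u ∈ binaryWords n ↔ u.length = n := by
  induction n generalizing u with
  | zero => simp [binaryWords]
  | succ n ih =>
    rcases u with _ | ⟨_ | _, u⟩ <;> simp [binaryWords, ih]

theorem sum_binaryWords_zero (f : List Bool → ℝ) : ∑ u ∈ binaryWords 0, f u = f [] := by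
  simp [binaryWords]

theorem sum_binaryWords_succ (f : List Bool → ℝ) (n : ℕ) :
    ∑ u ∈ binaryWords (n + 1), f u =
      ∑ u ∈ binaryWords n, (f (true :: u) + f (false :: u)) := by
  have hdisj : Disjoint ((binaryWords n).map ⟨List.cons true, List.cons_injective⟩)
      ((binaryWords n).map ⟨List.cons false, List.cons_injective⟩) := by
    simp [Finset.disjoint_left]
  simp [binaryWords, Finset.sum_union hdisj, Finset.sum_add_distrib]

theorem hasSum_of_hasSum_binaryWords {f : List Bool → ℝ} (hf : ∀ u, 0 ≤ f u) {a : ℝ}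
    (h : HasSum (fun n => ∑ u ∈ binaryWords n, f u) a) : HasSum f a := by
  have key (n : ℕ) : ∑' u : (binaryWords n : Set (List Bool)), f u =
      ∑ u ∈ binaryWords n, f u := Finset.tsum_subtype' _ _
  have hs : Summable f := by
    refine (summable_partition (s := fun n => (binaryWords n : Set (List Bool))) hf ?_).2 ⟨?_, ?_⟩
    · intro u
      simp [mem_binaryWords]
    · intro n
      exact (hasSum_fintype _).summable
    · simpa only [key] using h.summable
  have hfib := hs.hasSum.tsum_fiberwise List.length
  have hset (n : ℕ) : List.length ⁻¹' {n} = (binaryWords n : Set (List Bool)) := by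
    ext u
    simp [mem_binaryWords]
  have hfiber : (fun n : ℕ => ∑' u : (List.length ⁻¹' {n} : Set (List Bool)), f u) =
      fun n => ∑ u ∈ binaryWords n, f u := funext fun n => by rw [hset, key]
  rw [hfiber] at hfib
  exact hfib.unique h ▸ hs.hasSum

theorem occCount_cons (v : List Bool) (a : Bool) (u : List Bool) :
    occCount v (a :: u) = occCount v u + if v <+: a :: u then 1 else 0 := by
  rw [occCount, List.length_cons, List.range_succ_eq_map, List.countP_cons, List.countP_map]
  simp [occCount, Function.comp_def]

theorem occCount_pos_of_infix {v u : List Bool} (h : v <:+: u) : 0 < occCount v u := by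
  obtain ⟨s, t, rfl⟩ := h
  refine List.countP_pos_iff.2 ⟨s.length, ?_, ?_⟩
  · simp
  · simp

theorem occCount_append_1100 (x : List Bool) :
    occCount [true, true, false, false] (x ++ [true, true, false, false]) = 1 ↔
      ¬ [true, true, false, false] <:+: x := by
  induction x with
  | nil => decide
  | cons a x ih =>
    have hpos : 0 < occCount [true, true, false, false] (x ++ [true, true, false, false]) :=
      occCount_pos_of_infix (List.suffix_append _ _).isInfix
    have hpre : [true, true, false, false] <+: a :: (x ++ [true, true, false, false]) ↔
        [true, true, false, false] <+: a :: x := by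
      rcases x with _ | ⟨b, _ | ⟨c, _ | ⟨d, x⟩⟩⟩ <;> simp
    rw [List.cons_append, occCount_cons, List.infix_cons_iff, not_or, ← ih, ← hpre]
    split_ifs with h <;> simp [h]
    omega

theorem infix_append_1100 (x : List Bool) :
    [true, false, true, false] <:+: x ++ [true, true, false, false] ↔
      [true, false, true, false] <:+: x := by
  induction x with
  | nil => decide
  | cons a x ih =>
    have hpre : [true, false, true, false] <+: a :: (x ++ [true, true, false, false]) ↔
        [true, false, true, false] <+: a :: x := by
      rcases x with _ | ⟨b, _ | ⟨c, _ | ⟨d, x⟩⟩⟩ <;> simp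
    rw [List.cons_append, List.infix_cons_iff, List.infix_cons_iff, ih, hpre]

/-- Words containing neither `1100` nor `1010`. -/
def Avoiding (x : List Bool) : Prop :=
  ¬ [true, true, false, false] <:+: x ∧ ¬ [true, false, true, false] <:+: x

instance : DecidablePred Avoiding := fun _ => inferInstanceAs (Decidable (_ ∧ _))

theorem avoiding_nil : Avoiding [] := by decide

theorem avoiding_true_cons (x : List Bool) :
    Avoiding (true :: x) ↔ Avoiding x ∧ ¬ [true, false, false] <+: x ∧
      ¬ [false, true, false] <+: x := by
  simp only [Avoiding, List.infix_cons_iff, List.cons_prefix_cons, true_and]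
  tauto

theorem avoiding_false_cons (x : List Bool) : Avoiding (false :: x) ↔ Avoiding x := by
  simp [Avoiding, List.infix_cons_iff]

theorem mem_omegaWin_1100_iff (u : List Bool) :
    u ∈ OmegaWin [true, true, false, false] [true, false, true, false] ↔
      ∃ x, Avoiding x ∧ x ++ [true, true, false, false] = u := by
  constructor
  · rintro ⟨⟨x, rfl⟩, h1, h2⟩
    exact ⟨x, ⟨(occCount_append_1100 x).1 h1, fun h => h2 ((infix_append_1100 x).2 h)⟩, rfl⟩
  · rintro ⟨x, ⟨h1, h2⟩, rfl⟩
    exact ⟨List.suffix_append _ _, (occCount_append_1100 x).2 h1,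
      fun h => h2 ((infix_append_1100 x).1 h)⟩

theorem wProb_nonneg {p : ℝ} (hp : p ∈ Set.Ioo (0 : ℝ) 1) (u : List Bool) : 0 ≤ wProb p u :=
  mul_nonneg (pow_nonneg hp.1.le _) (pow_nonneg (sub_nonneg.2 hp.2.le) _)

@[simp] theorem wProb_nil (p : ℝ) : wProb p [] = 1 := by simp [wProb]

@[simp] theorem wProb_true_cons (p : ℝ) (u : List Bool) :
    wProb p (true :: u) = p * wProb p u := by
  simp [wProb, pow_succ]; ring

@[simp] theorem wProb_false_cons (p : ℝ) (u : List Bool) :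
    wProb p (false :: u) = (1 - p) * wProb p u := by
  simp [wProb, pow_succ]; ring

theorem wProb_append (p : ℝ) (u v : List Bool) :
    wProb p (u ++ v) = wProb p u * wProb p v := by
  simp [wProb, pow_add]; ring

/-- The weight of `u` if `u` avoids both words, and `0` otherwise. -/
noncomputable def avoidWeight (p : ℝ) (u : List Bool) : ℝ :=
  if Avoiding u then wProb p u else 0

/-- The weight of `u` if `u` avoids both words and does not start with `10`,
and `0` otherwise. -/
noncomputable def avoidWeightNoTen (p : ℝ) (u : List Bool) : ℝ :=
  if Avoiding u ∧ ¬ [true, false] <+: u then wProb p u else 0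

theorem win_1100_1010_eq_tsum (p : ℝ) :
    Win [true, true, false, false] [true, false, true, false] p =
      (p * (1 - p)) ^ 2 * ∑' u, avoidWeight p u := by
  have himage : OmegaWin [true, true, false, false] [true, false, true, false] =
      (fun x => x ++ [true, true, false, false]) '' {x | Avoiding x} :=
    Set.ext mem_omegaWin_1100_iff
  rw [Win, himage, tsum_image _ (List.append_left_injective _).injOn, ← tsum_mul_left,
    tsum_subtype {x | Avoiding x} fun x => wProb p (x ++ [true, true, false, false])]
  refine tsum_congr fun x => ?_
  simp only [Set.indicator, Set.mem_ofPred_eq, avoidWeight, wProb_append]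
  split_ifs
  · simp; ring
  · simp

/-- The total weight of the avoiding words of length `n`. -/
noncomputable def avoidMass (p : ℝ) (n : ℕ) : ℝ := ∑ u ∈ binaryWords n, avoidWeight p u

/-- The total weight of the avoiding words of length `n` that do not start with `10`. -/
noncomputable def avoidMassNoTen (p : ℝ) (n : ℕ) : ℝ :=
  ∑ u ∈ binaryWords n, avoidWeightNoTen p u

theorem avoidMass_add_four (p : ℝ) (n : ℕ) :
    avoidMass p (n + 4) = avoidMass p (n + 3) -
      (p * (1 - p)) ^ 2 * (avoidMass p n + avoidMassNoTen p n) := by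
  simp only [avoidMass, avoidMassNoTen, sum_binaryWords_succ]
  rw [← Finset.sum_add_distrib, Finset.mul_sum, ← Finset.sum_sub_distrib]
  refine Finset.sum_congr rfl fun u _ => ?_
  simp only [avoidWeight, avoidWeightNoTen, avoiding_true_cons, avoiding_false_cons,
    wProb_true_cons, wProb_false_cons, List.cons_prefix_cons]
  by_cases h : Avoiding u <;> by_cases h10 : [true, false] <+: u <;>
  by_cases h00 : [false, false] <+: u <;> by_cases h0 : [false] <+: u <;>
  by_cases h100 : [true, false, false] <+: u <;> by_cases h010 : [false, true, false] <+: u <;>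
  simp [h, h10, h00, h0, h100, h010] <;> ring

theorem avoidMassNoTen_add_two (p : ℝ) (n : ℕ) :
    avoidMassNoTen p (n + 2) = avoidMass p (n + 2) - p * (1 - p) * avoidMassNoTen p n := by
  simp only [avoidMass, avoidMassNoTen, sum_binaryWords_succ]
  rw [Finset.mul_sum, ← Finset.sum_sub_distrib]
  refine Finset.sum_congr rfl fun u _ => ?_
  by_cases h : Avoiding u <;> by_cases h10 : [true, false] <+: u <;>
  simp [avoidWeight, avoidWeightNoTen, avoiding_true_cons, avoiding_false_cons, h, h10]
  ring

theorem avoidMass_nonneg {p : ℝ} (hp : p ∈ Set.Ioo (0 : ℝ) 1) (n : ℕ) : 0 ≤ avoidMass p n :=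
  Finset.sum_nonneg fun u _ => by
    unfold avoidWeight
    split_ifs
    exacts [wProb_nonneg hp u, le_rfl]

theorem avoidMassNoTen_nonneg {p : ℝ} (hp : p ∈ Set.Ioo (0 : ℝ) 1) (n : ℕ) :
    0 ≤ avoidMassNoTen p n :=
  Finset.sum_nonneg fun u _ => by
    unfold avoidWeightNoTen
    split_ifs
    exacts [wProb_nonneg hp u, le_rfl]

theorem avoidMass_three (p : ℝ) : avoidMass p 3 = 1 := by
  simp [avoidMass, avoidWeight, sum_binaryWords_succ, sum_binaryWords_zero, avoiding_true_cons,
    avoiding_false_cons, avoiding_nil]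
  ring

theorem sum_avoidMass_add_avoidMassNoTen (p : ℝ) (n : ℕ) :
    (p * (1 - p)) ^ 2 * ∑ k ∈ Finset.range n, (avoidMass p k + avoidMassNoTen p k) =
      1 - avoidMass p (n + 3) := by
  induction n with
  | zero => simp [avoidMass_three]
  | succ n ih =>
    rw [Finset.sum_range_succ, mul_add, ih, show n + 1 + 3 = n + 4 by rfl, avoidMass_add_four]
    ring

theorem hasSum_avoidMass {p : ℝ} (hp : p ∈ Set.Ioo (0 : ℝ) 1) :
    HasSum (avoidMass p)
      ((1 + p * (1 - p)) / ((p * (1 - p)) ^ 2 * (2 + p * (1 - p)))) := by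
  have hx : 0 < p * (1 - p) := mul_pos hp.1 (sub_pos.2 hp.2)
  have hsum : Summable fun n => avoidMass p n + avoidMassNoTen p n := by
    refine summable_of_sum_range_le (c := 1 / (p * (1 - p)) ^ 2)
      (fun n => add_nonneg (avoidMass_nonneg hp n) (avoidMassNoTen_nonneg hp n)) fun n => ?_
    rw [le_div_iff₀' (by positivity), sum_avoidMass_add_avoidMassNoTen]
    linarith [avoidMass_nonneg hp (n + 3)]
  have hA : Summable (avoidMass p) :=
    hsum.of_nonneg_of_le (avoidMass_nonneg hp) fun n => by linarith [avoidMassNoTen_nonneg hp n]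
  have hB : Summable (avoidMassNoTen p) :=
    hsum.of_nonneg_of_le (avoidMassNoTen_nonneg hp) fun n => by linarith [avoidMass_nonneg hp n]
  have htotal : (p * (1 - p)) ^ 2 * (∑' n, avoidMass p n + ∑' n, avoidMassNoTen p n) = 1 := by
    rw [← hA.tsum_add hB]
    have h1 := hsum.hasSum.tendsto_sum_nat.const_mul ((p * (1 - p)) ^ 2)
    simp only [sum_avoidMass_add_avoidMassNoTen] at h1
    have h2 := ((Filter.tendsto_add_atTop_iff_nat 3).2 hA.tendsto_atTop_zero).const_sub 1
    rw [sub_zero] at h2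
    exact tendsto_nhds_unique h1 h2
  have hratio : ∑' n, avoidMassNoTen p n =
      ∑' n, avoidMass p n - p * (1 - p) * ∑' n, avoidMassNoTen p n := by
    have hinit : ∑ n ∈ Finset.range 2, avoidMassNoTen p n =
        ∑ n ∈ Finset.range 2, avoidMass p n := by
      simp [Finset.sum_range_succ, avoidMass, avoidMassNoTen, avoidWeight, avoidWeightNoTen,
        sum_binaryWords_succ, sum_binaryWords_zero]
    calc ∑' n, avoidMassNoTen p n
        = ∑ n ∈ Finset.range 2, avoidMassNoTen p n + ∑' n, avoidMassNoTen p (n + 2) :=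
          (hB.sum_add_tsum_nat_add 2).symm
      _ = ∑ n ∈ Finset.range 2, avoidMass p n + (∑' n, avoidMass p (n + 2) -
            p * (1 - p) * ∑' n, avoidMassNoTen p n) := by
          simp only [hinit, avoidMassNoTen_add_two]
          rw [((summable_nat_add_iff 2).2 hA).tsum_sub (hB.mul_left _), tsum_mul_left]
      _ = _ := by rw [← add_sub_assoc, hA.sum_add_tsum_nat_add 2]
  convert hA.hasSum using 1
  rw [div_eq_iff (by positivity)]
  linear_combination (-(1 + p * (1 - p))) * htotal + (p * (1 - p)) ^ 2 * hratio

/-- For `v = 1100`, `w = 1010`: `Win(v,w;p) = (1 + p(1-p))/(2 + p(1-p))`. -/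
theorem stmt16 (p : ℝ) (hp : p ∈ Set.Ioo (0:ℝ) 1) :
    Win [true, true, false, false] [true, false, true, false] p =
      (1 + p * (1 - p)) / (2 + p * (1 - p)) := by
  have hp0 : p ≠ 0 := hp.1.ne'
  have hq0 : 1 - p ≠ 0 := (sub_pos.2 hp.2).ne'
  have hnonneg (u : List Bool) : 0 ≤ avoidWeight p u := by
    unfold avoidWeight
    split_ifs
    exacts [wProb_nonneg hp u, le_rfl]
  rw [win_1100_1010_eq_tsum, (hasSum_of_hasSum_binaryWords hnonneg (hasSum_avoidMass hp)).tsum_eq]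
  field_simp
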